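/- arXiv:1508.03949 — 2 statements merged into one kernel-verified Lean document; each statement's English description precedes it below -/
import Mathlib

section
/- Let (A_n)_{n≥1} be a sequence of symmetric real n×n matrices satisfying the mean-field assumption. Then lim_{n→∞} (1/n)·[Φ_n − sup_{θ} M_n(θ)] = 0, where the supremum is over all n-tuples θ = (θ_1,…,θ_n) of probability vectors on {1,…,q}. -/
open Finset Filter Real

/-- The Potts Hamiltonian. -/
noncomputable def pottsH {n q : ℕ} (A : Matrix (Fin n) (Fin n) ℝ)
    (J : Matrix (Fin q) (Fin q) ℝ) (h : Fin q → ℝ) (y : Fin n → Fin q) : ℝ :=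
  (1 / 2) * ∑ i, ∑ j, A i j * J (y i) (y j) + ∑ i, h (y i)

/-- The log partition function. -/
noncomputable def pottsPhi {n q : ℕ} (A : Matrix (Fin n) (Fin n) ℝ)
    (J : Matrix (Fin q) (Fin q) ℝ) (h : Fin q → ℝ) : ℝ :=
  Real.log (∑ y : Fin n → Fin q, Real.exp (pottsH A J h y))

/-- Probability vectors on `{1,…,q}`. -/
def probVec {q : ℕ} (θ : Fin q → ℝ) : Prop :=
  (∀ r, 0 ≤ θ r) ∧ ∑ r, θ r = 1

/-- The mean-field functional. -/
noncomputable def meanField {n q : ℕ} (A : Matrix (Fin n) (Fin n) ℝ)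
    (J : Matrix (Fin q) (Fin q) ℝ) (h : Fin q → ℝ) (θ : Fin n → Fin q → ℝ) : ℝ :=
  (1 / 2) * ∑ i, ∑ j, A i j * (∑ r, ∑ s, θ i r * θ j s * J r s)
    + ∑ i, ∑ r, h r * θ i r - ∑ i, ∑ r, θ i r * Real.log (θ i r)

/-- The supremum of the mean-field functional over all n-tuples of probability vectors. -/
noncomputable def meanFieldSup {n q : ℕ} (A : Matrix (Fin n) (Fin n) ℝ)
    (J : Matrix (Fin q) (Fin q) ℝ) (h : Fin q → ℝ) : ℝ :=
  sSup {x | ∃ θ : Fin n → Fin q → ℝ, (∀ i, probVec (θ i)) ∧ x = meanField A J h θ}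

/-- The mean-field assumption on a sequence of matrices. -/
def meanFieldAssumption (A : (n : ℕ) → Matrix (Fin n) (Fin n) ℝ) : Prop :=
  (∃ C : ℝ, ∀ n : ℕ, ∀ x : Fin n → ℝ, (∀ j, x j ∈ Set.Icc (0:ℝ) 1) →
      ∑ i, |∑ j, A n i j * x j| ≤ C * n) ∧
  Tendsto (fun n : ℕ => Matrix.trace (A n * A n) / n) atTop (nhds 0)

section FiniteCondExp

variable {Ω T : Type*} [Fintype Ω] [DecidableEq T]

/-- Conditional expectation of `f` given the value of `τ`, for a weight `μ` on a finite type. -/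
noncomputable def finCondExp (μ : Ω → ℝ) (τ : Ω → T) (f : Ω → ℝ) (x : Ω) : ℝ :=
  (∑ y with τ y = τ x, μ y * f y) / ∑ y with τ y = τ x, μ y

lemma finCondExp_congr (μ : Ω → ℝ) (τ : Ω → T) (f : Ω → ℝ) {x y : Ω} (hxy : τ x = τ y) :
    finCondExp μ τ f x = finCondExp μ τ f y := by
  simp only [finCondExp, hxy]

lemma sum_fiber_pos {μ : Ω → ℝ} (hμ : ∀ x, 0 < μ x) (τ : Ω → T) (x : Ω) :
    0 < ∑ y with τ y = τ x, μ y :=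
  sum_pos (fun y _ => hμ y) ⟨x, by simp⟩

lemma finCondExp_nonneg {μ : Ω → ℝ} (hμ : ∀ x, 0 < μ x) (τ : Ω → T) {f : Ω → ℝ}
    (hf : ∀ x, 0 ≤ f x) (x : Ω) : 0 ≤ finCondExp μ τ f x :=
  div_nonneg (sum_nonneg fun y _ => mul_nonneg (hμ y).le (hf y)) (sum_fiber_pos hμ τ x).le

lemma finCondExp_pos {μ : Ω → ℝ} (hμ : ∀ x, 0 < μ x) (τ : Ω → T) {f : Ω → ℝ}
    (hf : ∀ x, 0 ≤ f x) {x : Ω} (hx : 0 < f x) : 0 < finCondExp μ τ f x :=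
  div_pos (sum_pos' (fun y _ => mul_nonneg (hμ y).le (hf y)) ⟨x, by simp, mul_pos (hμ x) hx⟩)
    (sum_fiber_pos hμ τ x)

lemma sum_finCondExp {ι : Type*} (s : Finset ι) (μ : Ω → ℝ) (τ : Ω → T) (f : ι → Ω → ℝ) (x : Ω) :
    ∑ r ∈ s, finCondExp μ τ (f r) x = finCondExp μ τ (fun y => ∑ r ∈ s, f r y) x := by
  simp only [finCondExp, ← sum_div, mul_sum]
  rw [sum_comm]

lemma finCondExp_one {μ : Ω → ℝ} (hμ : ∀ x, 0 < μ x) (τ : Ω → T) (x : Ω) :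
    finCondExp μ τ (fun _ => 1) x = 1 := by
  simp only [finCondExp, mul_one]
  exact div_self (sum_fiber_pos hμ τ x).ne'

lemma sum_mul_finCondExp {μ : Ω → ℝ} (hμ : ∀ x, 0 < μ x) (τ : Ω → T) (f g : Ω → ℝ)
    (hg : ∀ x y, τ x = τ y → g x = g y) :
    ∑ x, μ x * (g x * finCondExp μ τ f x) = ∑ x, μ x * (g x * f x) := by
  have key : ∀ x, μ x * (g x * finCondExp μ τ f x) = ∑ y, if τ y = τ x then
      μ x * (g x * (μ y * f y)) / ∑ z with τ z = τ x, μ z else 0 := by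
    intro x
    rw [finCondExp, ← sum_filter, ← sum_div, ← mul_sum, ← mul_sum, ← mul_div_assoc,
      ← mul_div_assoc]
  simp only [key]
  rw [sum_comm]
  refine sum_congr rfl fun y _ => ?_
  have h2 : ∀ x, (if τ y = τ x then
      μ x * (g x * (μ y * f y)) / ∑ z with τ z = τ x, μ z else 0) =
      if τ x = τ y then μ x * (g y * (μ y * f y) / ∑ z with τ z = τ y, μ z) else 0 := by
    intro x
    by_cases h : τ x = τ y
    · rw [if_pos h, if_pos h.symm, h, hg x y h, mul_div_assoc]
    · rw [if_neg h, if_neg (Ne.symm h)]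
  simp only [h2]
  rw [← sum_filter, ← sum_mul, mul_div_assoc']
  rw [mul_div_cancel_left₀ _ (sum_fiber_pos hμ τ y).ne']
  ring

/-- Conditional covariance. -/
noncomputable def finCondCov (μ : Ω → ℝ) (τ : Ω → T) (f g : Ω → ℝ) (x : Ω) : ℝ :=
  finCondExp μ τ (fun y => f y * g y) x - finCondExp μ τ f x * finCondExp μ τ g x

lemma sum_sq_finCondCov_le {T' : Type*} [DecidableEq T'] {μ : Ω → ℝ} (hμ : ∀ x, 0 < μ x)
    (τ : Ω → T) (τ' : Ω → T') (h_fine : ∀ x y, τ' x = τ' y → τ x = τ y) (f g : Ω → ℝ)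
    (hg : ∀ x y, τ' x = τ' y → g x = g y) (hg1 : ∀ x, g x ^ 2 ≤ 1) :
    ∑ x, μ x * finCondCov μ τ f g x ^ 2 ≤
      ∑ x, μ x * finCondExp μ τ' f x ^ 2 - ∑ x, μ x * finCondExp μ τ f x ^ 2 := by
  set c := finCondCov μ τ f g with hc
  set F := finCondExp μ τ f with hF
  set F' := finCondExp μ τ' f with hF'
  have cF : ∀ x y, τ x = τ y → F x = F y := fun x y h => finCondExp_congr μ τ f h
  have cc : ∀ x y, τ x = τ y → c x = c y := fun x y h => by
    simp only [hc, finCondCov, finCondExp_congr μ τ _ h]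
  have e1 : ∑ x, μ x * (c x * finCondExp μ τ (fun y => f y * g y) x) =
      ∑ x, μ x * (c x * (f x * g x)) := sum_mul_finCondExp hμ τ _ _ cc
  have e2 : ∑ x, μ x * (c x * F x * finCondExp μ τ g x) = ∑ x, μ x * (c x * F x * g x) :=
    sum_mul_finCondExp hμ τ _ (fun x => c x * F x) fun x y h => by simp only [cc x y h, cF x y h]
  have e3 : ∑ x, μ x * (c x * g x * F' x) = ∑ x, μ x * (c x * g x * f x) :=
    sum_mul_finCondExp hμ τ' _ (fun x => c x * g x) fun x y h => by
      simp only [cc x y (h_fine x y h), hg x y h]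
  have e4 : ∑ x, μ x * (F x * F' x) = ∑ x, μ x * (F x * f x) :=
    sum_mul_finCondExp hμ τ' _ _ fun x y h => cF x y (h_fine x y h)
  have e5 : ∑ x, μ x * (F x * F x) = ∑ x, μ x * (F x * f x) := sum_mul_finCondExp hμ τ _ _ cF
  have h1 : ∑ x, μ x * c x ^ 2 = ∑ x, μ x * (c x * g x * (F' x - F x)) := by
    have : ∀ x, μ x * c x ^ 2 = μ x * (c x * finCondExp μ τ (fun y => f y * g y) x) -
        μ x * (c x * F x * finCondExp μ τ g x) := fun x => by
      rw [sq]
      nth_rewrite 2 [hc]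
      simp only [finCondCov, hF]; ring
    simp only [this, mul_sub, sum_sub_distrib]
    rw [e1, e2, e3]
    congr 1 <;> exact sum_congr rfl fun x _ => by ring
  have h2 : ∑ x, μ x * (F' x - F x) ^ 2 = ∑ x, μ x * F' x ^ 2 - ∑ x, μ x * F x ^ 2 := by
    have : ∀ x, μ x * (F' x - F x) ^ 2 = μ x * F' x ^ 2 - μ x * F x ^ 2 -
      2 * (μ x * (F x * F' x)) + 2 * (μ x * (F x * F x)) := fun x => by ring
    simp only [this, sum_add_distrib, sum_sub_distrib, ← mul_sum]
    rw [e4, e5]; ring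
  have h3 : ∑ x, μ x * (c x * g x * (F' x - F x)) ≤
      (∑ x, μ x * c x ^ 2) / 2 + (∑ x, μ x * (F' x - F x) ^ 2) / 2 := by
    rw [sum_div, sum_div, ← sum_add_distrib]
    refine sum_le_sum fun x _ => ?_
    have : c x * g x * (F' x - F x) ≤ c x ^ 2 / 2 + (F' x - F x) ^ 2 / 2 := by
      nlinarith [sq_nonneg (c x * g x - (F' x - F x)),
        mul_le_mul_of_nonneg_left (hg1 x) (sq_nonneg (c x))]
    nlinarith [mul_le_mul_of_nonneg_left this (hμ x).le]
  linarith

end FiniteCondExp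

/-- The Gibbs inequality for a nonnegative weight against a positive one. -/
lemma sum_mul_log_sub_log_le {Ω : Type*} [Fintype Ω] (p w : Ω → ℝ) (hp : ∀ x, 0 ≤ p x)
    (hw : ∀ x, 0 < w x) :
    ∑ x, p x * (log (w x) - log (p x)) ≤ ∑ x, w x - ∑ x, p x := by
  rw [← sum_sub_distrib]
  refine sum_le_sum fun x _ => ?_
  rcases (hp x).eq_or_lt with h | h
  · rw [← h]; simpa using (hw x).le
  · rw [← log_div (hw x).ne' h.ne']
    have := mul_le_mul_of_nonneg_left (log_le_sub_one_of_pos (div_pos (hw x) h)) h.le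
    rwa [mul_sub, mul_div_cancel₀ _ h.ne', mul_one] at this

section ProductMeasure

variable {n q : ℕ}

lemma sum_prod_eq_prod_sum (f : Fin n → Fin q → ℝ) :
    ∑ y : Fin n → Fin q, ∏ k, f k (y k) = ∏ k, ∑ r, f k r := by
  rw [prod_univ_sum, Fintype.piFinset_univ]

lemma sum_prod_eq_one {θ : Fin n → Fin q → ℝ} (hθ : ∀ i, probVec (θ i)) :
    ∑ y : Fin n → Fin q, ∏ k, θ k (y k) = 1 := by
  rw [sum_prod_eq_prod_sum]
  exact prod_eq_one fun k _ => (hθ k).2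

lemma sum_prod_mul_marginal {θ : Fin n → Fin q → ℝ} (hθ : ∀ i, probVec (θ i)) (i : Fin n)
    (u : Fin q → ℝ) :
    ∑ y : Fin n → Fin q, (∏ k, θ k (y k)) * u (y i) = ∑ r, θ i r * u r := by
  have := sum_prod_eq_prod_sum fun k r => θ k r * if k = i then u r else 1
  simp only [prod_mul_distrib, prod_ite_eq', mem_univ, if_true] at this
  rw [this, prod_eq_single i]
  · simp
  · intro k _ hk
    simpa [hk] using (hθ k).2
  · simp

lemma sum_prod_mul_pair_marginal {θ : Fin n → Fin q → ℝ} (hθ : ∀ i, probVec (θ i)) {i j : Fin n}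
    (hij : i ≠ j) (J : Fin q → Fin q → ℝ) :
    ∑ y : Fin n → Fin q, (∏ k, θ k (y k)) * J (y i) (y j) =
      ∑ r, ∑ s, θ i r * θ j s * J r s := by
  have key : ∀ u v : Fin q → ℝ, ∑ y : Fin n → Fin q, (∏ k, θ k (y k)) * (u (y i) * v (y j)) =
      (∑ r, θ i r * u r) * ∑ s, θ j s * v s := by
    intro u v
    have := sum_prod_eq_prod_sum fun k r =>
      θ k r * ((if k = i then u r else 1) * if k = j then v r else 1)
    simp only [prod_mul_distrib, prod_ite_eq', mem_univ, if_true] at this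
    rw [this, prod_eq_mul i j hij]
    · simp [hij, hij.symm]
    · intro k _ hk
      simpa [hk.1, hk.2] using (hθ k).2
    · simp
    · simp
  have hJ : ∀ y : Fin n → Fin q, J (y i) (y j) = ∑ r, ∑ s, J r s *
      ((if y i = r then 1 else 0) * if y j = s then 1 else 0) := by
    intro y; simp
  simp only [hJ, mul_sum]
  rw [sum_comm]
  refine sum_congr rfl fun r _ => ?_
  rw [sum_comm]
  refine sum_congr rfl fun s _ => ?_
  have := key (fun a => if a = r then 1 else 0) (fun a => if a = s then 1 else 0)
  simp only [mul_ite, mul_one, mul_zero, sum_ite_eq', mem_univ, if_true] at this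
  rw [← this, sum_mul]
  refine sum_congr rfl fun y _ => ?_
  split_ifs <;> ring

lemma sum_prod_mul_log {θ : Fin n → Fin q → ℝ} (hθ : ∀ i, probVec (θ i)) :
    ∑ y : Fin n → Fin q, (∏ k, θ k (y k)) * log (∏ k, θ k (y k)) =
      ∑ i, ∑ r, θ i r * log (θ i r) := by
  have h1 : ∀ y : Fin n → Fin q, (∏ k, θ k (y k)) * log (∏ k, θ k (y k)) =
      ∑ i, (∏ k, θ k (y k)) * log (θ i (y i)) := by
    intro y
    rw [← mul_sum]
    by_cases h : ∏ k, θ k (y k) = 0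
    · simp [h]
    · rw [log_prod fun k hk => prod_ne_zero_iff.1 h k hk]
  simp only [h1]
  rw [sum_comm]
  exact sum_congr rfl fun i _ => sum_prod_mul_marginal hθ i fun r => log (θ i r)

end ProductMeasure

section LowerBound

variable {n q : ℕ}

lemma sum_mul_pottsH_sub_log_le (A : Matrix (Fin n) (Fin n) ℝ) (J : Matrix (Fin q) (Fin q) ℝ)
    (h : Fin q → ℝ) (hq : 0 < q) (p : (Fin n → Fin q) → ℝ) (hp : ∀ y, 0 ≤ p y)
    (hp1 : ∑ y, p y = 1) :
    ∑ y, p y * pottsH A J h y - ∑ y, p y * log (p y) ≤ pottsPhi A J h := by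
  have : Nonempty (Fin q) := ⟨⟨0, hq⟩⟩
  have hZ : 0 < ∑ y : Fin n → Fin q, exp (pottsH A J h y) :=
    sum_pos (fun y _ => exp_pos _) univ_nonempty
  have := sum_mul_log_sub_log_le p
    (fun y => exp (pottsH A J h y) / ∑ y : Fin n → Fin q, exp (pottsH A J h y)) hp
    fun y => div_pos (exp_pos _) hZ
  rw [← sum_div, div_self hZ.ne', hp1] at this
  simp only [log_div (exp_pos _).ne' hZ.ne', log_exp, mul_sub, sum_sub_distrib, ← sum_mul,
    hp1] at this
  rw [pottsPhi]
  linarith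

lemma probVec.le_one {θ : Fin q → ℝ} (hθ : probVec θ) (r : Fin q) : θ r ≤ 1 :=
  hθ.2 ▸ single_le_sum (fun s _ => hθ.1 s) (mem_univ r)

lemma abs_diagonal_correction_le (J : Matrix (Fin q) (Fin q) ℝ) {θ : Fin q → ℝ}
    (hθ : probVec θ) :
    |∑ r, ∑ s, θ r * θ s * J r s - ∑ r, θ r * J r r| ≤ 2 * ∑ r, ∑ s, |J r s| := by
  have h1 : |∑ r, ∑ s, θ r * θ s * J r s| ≤ ∑ r, ∑ s, |J r s| := by
    refine (abs_sum_le_sum_abs _ _).trans (sum_le_sum fun r _ => ?_)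
    refine (abs_sum_le_sum_abs _ _).trans (sum_le_sum fun s _ => ?_)
    rw [abs_mul, abs_of_nonneg (mul_nonneg (hθ.1 r) (hθ.1 s))]
    exact mul_le_of_le_one_left (abs_nonneg _)
      (mul_le_one₀ (hθ.le_one r) (hθ.1 s) (hθ.le_one s))
  have h2 : |∑ r, θ r * J r r| ≤ ∑ r, ∑ s, |J r s| := by
    refine (abs_sum_le_sum_abs _ _).trans (sum_le_sum fun r _ => ?_)
    rw [abs_mul, abs_of_nonneg (hθ.1 r)]
    exact (mul_le_of_le_one_left (abs_nonneg _) (hθ.le_one r)).trans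
      (single_le_sum (f := fun s => |J r s|) (fun s _ => abs_nonneg _) (mem_univ r))
  have := abs_sub (∑ r, ∑ s, θ r * θ s * J r s) (∑ r, θ r * J r r)
  linarith

lemma meanField_le (A : Matrix (Fin n) (Fin n) ℝ) (J : Matrix (Fin q) (Fin q) ℝ) (h : Fin q → ℝ)
    (hq : 0 < q) {θ : Fin n → Fin q → ℝ} (hθ : ∀ i, probVec (θ i)) :
    meanField A J h θ ≤ pottsPhi A J h + (∑ i, |A i i|) * ∑ r, ∑ s, |J r s| := by
  have hG := sum_mul_pottsH_sub_log_le A J h hq (fun y => ∏ k, θ k (y k))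
    (fun y => prod_nonneg fun k _ => (hθ k).1 _) (sum_prod_eq_one hθ)
  rw [sum_prod_mul_log hθ] at hG
  have hH : ∑ y : Fin n → Fin q, (∏ k, θ k (y k)) * pottsH A J h y =
      (1 / 2) * ∑ i, ∑ j, A i j * (∑ y : Fin n → Fin q, (∏ k, θ k (y k)) * J (y i) (y j)) +
      ∑ i, ∑ r, h r * θ i r := by
    simp only [pottsH, mul_add, sum_add_distrib]
    congr 1
    · simp only [mul_sum]
      rw [sum_comm]
      refine sum_congr rfl fun i _ => ?_
      rw [sum_comm]
      refine sum_congr rfl fun j _ => sum_congr rfl fun y _ => by ring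
    · simp only [mul_sum]
      rw [sum_comm]
      refine sum_congr rfl fun i _ => ?_
      rw [sum_prod_mul_marginal hθ i h]
      exact sum_congr rfl fun r _ => mul_comm _ _
  have hD : ∑ i, ∑ j, A i j * (∑ r, ∑ s, θ i r * θ j s * J r s) -
      ∑ i, ∑ j, A i j * (∑ y : Fin n → Fin q, (∏ k, θ k (y k)) * J (y i) (y j)) ≤
      (∑ i, |A i i|) * (2 * ∑ r, ∑ s, |J r s|) := by
    rw [← sum_sub_distrib, sum_mul]
    refine sum_le_sum fun i _ => ?_
    rw [← sum_sub_distrib, sum_eq_single i]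
    · rw [sum_prod_mul_marginal hθ i fun r => J r r, ← mul_sub]
      refine (le_abs_self _).trans ?_
      rw [abs_mul]
      exact mul_le_mul_of_nonneg_left (abs_diagonal_correction_le J (hθ i)) (abs_nonneg _)
    · intro j _ hj
      rw [sum_prod_mul_pair_marginal hθ hj.symm J, sub_self]
    · simp
  rw [meanField]
  linarith

lemma bddAbove_meanField (A : Matrix (Fin n) (Fin n) ℝ) (J : Matrix (Fin q) (Fin q) ℝ)
    (h : Fin q → ℝ) (hq : 0 < q) :
    BddAbove {x | ∃ θ : Fin n → Fin q → ℝ, (∀ i, probVec (θ i)) ∧ x = meanField A J h θ} := by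
  refine ⟨pottsPhi A J h + (∑ i, |A i i|) * ∑ r, ∑ s, |J r s|, ?_⟩
  rintro x ⟨θ, hθ, rfl⟩
  exact meanField_le A J h hq hθ

lemma exists_probVec (hq : 0 < q) : ∃ θ : Fin q → ℝ, probVec θ :=
  ⟨Pi.single ⟨0, hq⟩ 1, fun r => by by_cases hr : r = ⟨0, hq⟩ <;> simp [hr],
    by simp⟩

lemma meanFieldSup_le (A : Matrix (Fin n) (Fin n) ℝ) (J : Matrix (Fin q) (Fin q) ℝ)
    (h : Fin q → ℝ) (hq : 0 < q) :
    meanFieldSup A J h ≤ pottsPhi A J h + (∑ i, |A i i|) * ∑ r, ∑ s, |J r s| := by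
  obtain ⟨θ, hθ⟩ := exists_probVec hq
  refine csSup_le ⟨_, fun _ => θ, fun _ => hθ, rfl⟩ ?_
  rintro x ⟨θ, hθ, rfl⟩
  exact meanField_le A J h hq hθ

end LowerBound

section UpperBound

variable {n q : ℕ}

/-- The indicator that site `i` has colour `r`. -/
def colourInd (i : Fin n) (r : Fin q) (x : Fin n → Fin q) : ℝ := if x i = r then 1 else 0

lemma colourInd_nonneg (i : Fin n) (r : Fin q) (x : Fin n → Fin q) : 0 ≤ colourInd i r x := by
  unfold colourInd; split_ifs <;> simp

lemma colourInd_sq_le_one (i : Fin n) (r : Fin q) (x : Fin n → Fin q) :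
    colourInd i r x ^ 2 ≤ 1 := by
  unfold colourInd; split_ifs <;> simp

/-- The conditional law of the colour of site `i`, given the colours on `S`. -/
noncomputable def condMarginal (μ : (Fin n → Fin q) → ℝ) (S : Finset (Fin n)) (x : Fin n → Fin q)
    (i : Fin n) (r : Fin q) : ℝ :=
  finCondExp μ S.restrict (colourInd i r) x

lemma probVec_condMarginal {μ : (Fin n → Fin q) → ℝ} (hμ : ∀ x, 0 < μ x) (S : Finset (Fin n))
    (x : Fin n → Fin q) (i : Fin n) : probVec (condMarginal μ S x i) := by
  refine ⟨fun r => finCondExp_nonneg hμ _ (colourInd_nonneg i r) x, ?_⟩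
  simp only [condMarginal]
  rw [sum_finCondExp, ← finCondExp_one hμ (S.restrict) x]
  congr 1
  funext y
  simp [colourInd]

lemma exists_small_pinning {μ : (Fin n → Fin q) → ℝ} (hμ : ∀ x, 0 < μ x) (hμ1 : ∑ x, μ x = 1)
    {δ : ℝ} (hδ : 0 < δ) :
    ∃ S : Finset (Fin n), δ * #S ≤ n * q ∧
      ∑ i, ∑ j, ∑ r, ∑ s, ∑ x, μ x *
        finCondCov μ S.restrict (colourInd i r) (colourInd j s) x ^ 2 ≤ n * q * δ := by
  set Q : Finset (Fin n) → ℝ := fun S =>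
    ∑ i, ∑ r, ∑ x, μ x * condMarginal μ S x i r ^ 2 with hQ
  have hQ0 : ∀ S, 0 ≤ Q S := fun S => sum_nonneg fun i _ => sum_nonneg fun r _ =>
    sum_nonneg fun x _ => mul_nonneg (hμ x).le (sq_nonneg _)
  have hQn : ∀ S, Q S ≤ n * q := fun S => by
    have : ∀ i : Fin n, ∀ r : Fin q, ∑ x, μ x * condMarginal μ S x i r ^ 2 ≤ 1 := fun i r => by
      rw [← hμ1]
      refine sum_le_sum fun x _ => mul_le_of_le_one_right (hμ x).le ?_
      have hp := probVec_condMarginal hμ S x i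
      exact pow_le_one₀ (hp.1 r) (hp.le_one r)
    calc Q S ≤ ∑ _i : Fin n, ∑ _r : Fin q, (1 : ℝ) :=
          sum_le_sum fun i _ => sum_le_sum fun r _ => this i r
      _ = n * q := by simp
  obtain ⟨S, -, hS⟩ := exists_max_image (univ : Finset (Finset (Fin n)))
    (fun S => Q S - δ * #S) univ_nonempty
  refine ⟨S, ?_, ?_⟩
  · have := hS ∅ (mem_univ _)
    simp only [card_empty, Nat.cast_zero, mul_zero, sub_zero] at this
    linarith [hQ0 ∅, hQn S]
  · have step : ∀ j : Fin n, ∀ s : Fin q, ∑ i, ∑ r, ∑ x, μ x *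
        finCondCov μ S.restrict (colourInd i r) (colourInd j s) x ^ 2 ≤ δ := by
      intro j s
      have h1 := hS (insert j S) (mem_univ _)
      have h2 : (#(insert j S) : ℝ) ≤ #S + 1 := by exact_mod_cast card_insert_le j S
      have h3 : Q (insert j S) - Q S ≤ δ := by nlinarith
      refine le_trans ?_ h3
      simp only [hQ]
      rw [← sum_sub_distrib]
      refine sum_le_sum fun i _ => ?_
      rw [← sum_sub_distrib]
      refine sum_le_sum fun r _ => ?_
      refine sum_sq_finCondCov_le hμ S.restrict (insert j S).restrict ?_ _ _ ?_
        (colourInd_sq_le_one j s)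
      · intro x y hxy
        funext k
        exact congrFun hxy ⟨k, mem_insert_of_mem k.2⟩
      · intro x y hxy
        have : x j = y j := congrFun hxy ⟨j, mem_insert_self j S⟩
        simp only [colourInd, this]
    calc _ = ∑ j, ∑ s, ∑ i, ∑ r, ∑ x, μ x *
          finCondCov μ S.restrict (colourInd i r) (colourInd j s) x ^ 2 := by
          rw [sum_comm]
          refine sum_congr rfl fun j _ => ?_
          rw [sum_comm (s := (univ : Finset (Fin q)))]
          refine sum_congr rfl fun i _ => ?_
          rw [sum_comm]
      _ ≤ ∑ _j : Fin n, ∑ _s : Fin q, δ := sum_le_sum fun j _ => sum_le_sum fun s _ => step j s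
      _ = n * q * δ := by simp; ring

lemma entropy_le {μ : (Fin n → Fin q) → ℝ} (hμ : ∀ x, 0 < μ x) (hμ1 : ∑ x, μ x = 1)
    (hq : 0 < q) (S : Finset (Fin n)) :
    - ∑ x, μ x * log (μ x) ≤ #S * log q -
      ∑ x, μ x * ∑ i, ∑ r, condMarginal μ S x i r * log (condMarginal μ S x i r) := by
  have hq' : (0 : ℝ) < q := by exact_mod_cast hq
  have hqS : (0 : ℝ) < (q : ℝ) ^ #S := pow_pos hq' _
  have hpos : ∀ x : Fin n → Fin q, ∀ i, 0 < condMarginal μ S x i (x i) := fun x i =>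
    finCondExp_pos hμ _ (colourInd_nonneg i (x i)) (by simp [colourInd])
  have hprod : ∀ x : Fin n → Fin q, 0 < ∏ i, condMarginal μ S x i (x i) :=
    fun x => prod_pos fun i _ => hpos x i
  have hν : ∑ x : Fin n → Fin q, ∏ i, condMarginal μ S x i (x i) ≤ (q : ℝ) ^ #S := by
    rw [← sum_fiberwise univ (S.restrict : (Fin n → Fin q) → S → Fin q)]
    calc _ ≤ ∑ _t : S → Fin q, (1 : ℝ) := by
          refine sum_le_sum fun t _ => ?_
          rcases (univ.filter fun x : Fin n → Fin q => S.restrict x = t).eq_empty_or_nonempty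
            with he | ⟨x₀, hx₀⟩
          · rw [he]; simp
          · rw [← sum_prod_eq_one (probVec_condMarginal hμ S x₀)]
            rw [sum_congr rfl (g := fun y => ∏ i, condMarginal μ S x₀ i (y i))]
            · exact sum_le_univ_sum_of_nonneg fun y =>
                prod_nonneg fun i _ => (probVec_condMarginal hμ S x₀ i).1 _
            · intro y hy
              refine prod_congr rfl fun i _ => finCondExp_congr μ _ _ ?_
              rw [(mem_filter.1 hy).2, (mem_filter.1 hx₀).2]
      _ = (q : ℝ) ^ #S := by simp
  have hG := sum_mul_log_sub_log_le μ (fun x => (∏ i, condMarginal μ S x i (x i)) / (q : ℝ) ^ #S)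
    (fun x => (hμ x).le) fun x => div_pos (hprod x) hqS
  rw [← sum_div, hμ1] at hG
  have hG0 : (∑ x : Fin n → Fin q, ∏ i, condMarginal μ S x i (x i)) / (q : ℝ) ^ #S ≤ 1 :=
    (div_le_one hqS).2 hν
  simp only [log_div (hprod _).ne' hqS.ne', log_pow, mul_sub, sum_sub_distrib, ← sum_mul,
    hμ1] at hG
  have hE : ∑ x, μ x * log (∏ i, condMarginal μ S x i (x i)) =
      ∑ x, μ x * ∑ i, ∑ r, condMarginal μ S x i r * log (condMarginal μ S x i r) := by
    have h1 : ∀ x : Fin n → Fin q, log (∏ i, condMarginal μ S x i (x i)) =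
        ∑ i, ∑ r, log (condMarginal μ S x i r) * colourInd i r x := fun x => by
      rw [log_prod fun i _ => (hpos x i).ne']
      simp [colourInd]
    simp only [h1, mul_sum]
    rw [sum_comm, sum_comm (s := (univ : Finset (Fin n → Fin q)))]
    refine sum_congr rfl fun i _ => ?_
    rw [sum_comm, sum_comm (s := (univ : Finset (Fin n → Fin q)))]
    refine sum_congr rfl fun r _ => ?_
    rw [← sum_mul_finCondExp hμ S.restrict _ fun x => log (condMarginal μ S x i r)]
    · exact sum_congr rfl fun x _ => by rw [condMarginal]; ring
    · intro x y hxy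
      simp only [condMarginal, finCondExp_congr μ _ _ hxy]
  rw [hE] at hG
  linarith

lemma energy_eq {μ : (Fin n → Fin q) → ℝ} (hμ : ∀ x, 0 < μ x) (A : Matrix (Fin n) (Fin n) ℝ)
    (J : Matrix (Fin q) (Fin q) ℝ) (h : Fin q → ℝ) (S : Finset (Fin n)) :
    ∑ x, μ x * pottsH A J h x = ∑ x, μ x * (meanField A J h (condMarginal μ S x) +
        ∑ i, ∑ r, condMarginal μ S x i r * log (condMarginal μ S x i r)) +
      (1 / 2) * ∑ i, ∑ j, ∑ r, ∑ s, ∑ x, μ x * (A i j * J r s *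
        finCondCov μ S.restrict (colourInd i r) (colourInd j s) x) := by
  have h1 : ∀ f : (Fin n → Fin q) → ℝ,
      ∑ x, μ x * f x = ∑ x, μ x * finCondExp μ S.restrict f x := fun f => by
    have := sum_mul_finCondExp hμ S.restrict f (fun _ => 1) fun _ _ _ => rfl
    simpa using this.symm
  have hH : ∀ x, pottsH A J h x = (1 / 2) * ∑ i, ∑ j, ∑ r, ∑ s,
      A i j * J r s * (colourInd i r x * colourInd j s x) + ∑ i, ∑ r, h r * colourInd i r x := by
    intro x
    simp [pottsH, colourInd]
  have hM : ∀ x, meanField A J h (condMarginal μ S x) +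
        ∑ i, ∑ r, condMarginal μ S x i r * log (condMarginal μ S x i r) =
      (1 / 2) * ∑ i, ∑ j, ∑ r, ∑ s,
      A i j * J r s * (condMarginal μ S x i r * condMarginal μ S x j s) +
      ∑ i, ∑ r, h r * condMarginal μ S x i r := by
    intro x
    simp only [meanField, mul_sum, sub_add_cancel]
    congr 1
    refine sum_congr rfl fun i _ => sum_congr rfl fun j _ => sum_congr rfl fun r _ =>
      sum_congr rfl fun s _ => by ring
  have swap2 : ∀ F : (Fin n → Fin q) → Fin n → Fin q → ℝ,
      ∑ x, μ x * ∑ i, ∑ r, F x i r = ∑ i, ∑ r, ∑ x, μ x * F x i r := by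
    intro F
    simp only [mul_sum]
    rw [sum_comm]
    refine sum_congr rfl fun i _ => ?_
    rw [sum_comm]
  have swap4 : ∀ F : (Fin n → Fin q) → Fin n → Fin n → Fin q → Fin q → ℝ,
      ∑ x, μ x * ((1 / 2) * ∑ i, ∑ j, ∑ r, ∑ s, F x i j r s) =
      (1 / 2) * ∑ i, ∑ j, ∑ r, ∑ s, ∑ x, μ x * F x i j r s := by
    intro F
    simp only [mul_left_comm (μ _) (1 / 2 : ℝ)]
    rw [← mul_sum]
    congr 1
    simp only [mul_sum]
    rw [sum_comm]
    refine sum_congr rfl fun i _ => ?_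
    rw [sum_comm]
    refine sum_congr rfl fun j _ => ?_
    rw [sum_comm]
    refine sum_congr rfl fun r _ => ?_
    rw [sum_comm]
  simp only [hH, hM, mul_add, sum_add_distrib, swap2, swap4]
  rw [add_right_comm, ← mul_add]
  congr 1
  · congr 1
    simp only [← sum_add_distrib]
    refine sum_congr rfl fun i _ => sum_congr rfl fun j _ => sum_congr rfl fun r _ =>
      sum_congr rfl fun s _ => ?_
    have := h1 fun x => colourInd i r x * colourInd j s x
    simp only [mul_left_comm (μ _) (A i j * J r s)]
    rw [← mul_sum, this, mul_sum]
    refine sum_congr rfl fun x _ => ?_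
    simp only [finCondCov, condMarginal]
    ring
  · refine sum_congr rfl fun i _ => sum_congr rfl fun r _ => ?_
    simp only [mul_left_comm (μ _) (h r)]
    rw [← mul_sum, h1, mul_sum]
    rfl

lemma pottsPhi_le (A : Matrix (Fin n) (Fin n) ℝ) (J : Matrix (Fin q) (Fin q) ℝ) (h : Fin q → ℝ)
    (hq : 0 < q) {δ η : ℝ} (hδ : 0 < δ) (hη : 0 < η) :
    pottsPhi A J h ≤ meanFieldSup A J h + n * q / δ * log q +
      (∑ i, ∑ j, A i j ^ 2) * (∑ r, ∑ s, J r s ^ 2) / η + n * q * δ * η := by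
  have : Nonempty (Fin q) := ⟨⟨0, hq⟩⟩
  have hZ : 0 < ∑ y : Fin n → Fin q, exp (pottsH A J h y) :=
    sum_pos (fun y _ => exp_pos _) univ_nonempty
  set μ : (Fin n → Fin q) → ℝ :=
    fun x => exp (pottsH A J h x) / ∑ y : Fin n → Fin q, exp (pottsH A J h y) with hμdef
  have hμ : ∀ x, 0 < μ x := fun x => div_pos (exp_pos _) hZ
  have hμ1 : ∑ x, μ x = 1 := by rw [← sum_div, div_self hZ.ne']
  obtain ⟨S, hS, hcov⟩ := exists_small_pinning hμ hμ1 hδ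
  have hlog : 0 ≤ log q := log_nonneg (by exact_mod_cast hq)
  have hSle : #S * log q ≤ n * q / δ * log q := by
    refine mul_le_mul_of_nonneg_right ?_ hlog
    rw [le_div_iff₀ hδ]; linarith
  have hPhi : pottsPhi A J h = ∑ x, μ x * pottsH A J h x - ∑ x, μ x * log (μ x) := by
    rw [← sum_sub_distrib]
    have : ∀ x, μ x * pottsH A J h x - μ x * log (μ x) = μ x * pottsPhi A J h := fun x => by
      rw [← mul_sub]
      congr 1
      simp only [hμdef]
      rw [log_div (exp_pos _).ne' hZ.ne', log_exp, pottsPhi]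
      ring
    simp only [this]
    rw [← sum_mul, hμ1, one_mul]
  have hent := entropy_le hμ hμ1 hq S
  have hen := energy_eq hμ A J h S
  simp only [mul_add, sum_add_distrib] at hen
  have hsup : ∑ x, μ x * meanField A J h (condMarginal μ S x) ≤ meanFieldSup A J h := by
    calc _ ≤ ∑ x, μ x * meanFieldSup A J h :=
          sum_le_sum fun x _ => mul_le_mul_of_nonneg_left
            (le_csSup (bddAbove_meanField A J h hq)
              ⟨_, fun i => probVec_condMarginal hμ S x i, rfl⟩) (hμ x).le
      _ = _ := by rw [← sum_mul, hμ1, one_mul]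
  have herr : (1 / 2) * ∑ i, ∑ j, ∑ r, ∑ s, ∑ x, μ x * (A i j * J r s *
        finCondCov μ S.restrict (colourInd i r) (colourInd j s) x) ≤
      (∑ i, ∑ j, A i j ^ 2) * (∑ r, ∑ s, J r s ^ 2) / η + n * q * δ * η := by
    have h1 : ∀ i j r s, ∑ x, μ x * (A i j * J r s *
        finCondCov μ S.restrict (colourInd i r) (colourInd j s) x) ≤
        A i j ^ 2 * J r s ^ 2 / η + η * ∑ x, μ x *
          finCondCov μ S.restrict (colourInd i r) (colourInd j s) x ^ 2 := by
      intro i j r s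
      have : A i j ^ 2 * J r s ^ 2 / η = ∑ x, μ x * (A i j ^ 2 * J r s ^ 2 / η) := by
        rw [← sum_mul, hμ1, one_mul]
      rw [this, mul_sum, ← sum_add_distrib]
      refine sum_le_sum fun x _ => ?_
      rw [mul_left_comm η, ← mul_add]
      refine mul_le_mul_of_nonneg_left ?_ (hμ x).le
      set c := finCondCov μ S.restrict (colourInd i r) (colourInd j s) x
      rw [← mul_pow, ← sub_nonneg]
      have : (A i j * J r s) ^ 2 / η + η * c ^ 2 - A i j * J r s * c =
          ((A i j * J r s - η * c) ^ 2 + (A i j * J r s) ^ 2 + (η * c) ^ 2) / (2 * η) := by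
        field_simp
        ring
      rw [this]
      positivity
    have h2 := sum_le_sum fun i (_ : i ∈ univ) => sum_le_sum fun j (_ : j ∈ univ) =>
      sum_le_sum fun r (_ : r ∈ univ) => sum_le_sum fun s (_ : s ∈ univ) => h1 i j r s
    simp only [sum_add_distrib, ← mul_sum, ← sum_div, ← sum_mul] at h2
    have h3 := mul_le_mul_of_nonneg_left hcov hη.le
    have h4 : 0 ≤ (∑ i, ∑ j, A i j ^ 2) * (∑ r, ∑ s, J r s ^ 2) / η := by positivity
    have h5 : 0 ≤ n * q * δ * η := by positivity
    linarith
  linarith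

end UpperBound

lemma trace_mul_self_eq_sum_sq {n : ℕ} {A : Matrix (Fin n) (Fin n) ℝ} (hA : A.IsSymm) :
    Matrix.trace (A * A) = ∑ i, ∑ j, A i j ^ 2 := by
  simp only [Matrix.trace, Matrix.diag, Matrix.mul_apply]
  exact sum_congr rfl fun i _ => sum_congr rfl fun j _ => by rw [hA.apply i j, sq]

lemma sum_abs_diagonal_le {n : ℕ} (A : Matrix (Fin n) (Fin n) ℝ) {ε : ℝ} (hε : 0 < ε) :
    ∑ i, |A i i| ≤ n * ε + (∑ i, ∑ j, A i j ^ 2) / ε := by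
  have h1 : ∀ i, |A i i| ≤ ε + (∑ j, A i j ^ 2) / ε := by
    intro i
    have h2 : A i i ^ 2 ≤ ∑ j, A i j ^ 2 :=
      single_le_sum (f := fun j => A i j ^ 2) (fun j _ => sq_nonneg _) (mem_univ i)
    have h3 : |A i i| ≤ ε + A i i ^ 2 / ε := by
      rw [← sq_abs, ← sub_nonneg]
      have : ε + |A i i| ^ 2 / ε - |A i i| =
          ((ε - |A i i|) ^ 2 + ε ^ 2 + |A i i| ^ 2) / (2 * ε) := by
        field_simp
        ring
      rw [this]
      positivity
    have := div_le_div_of_nonneg_right h2 hε.le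
    linarith
  calc _ ≤ ∑ i, (ε + (∑ j, A i j ^ 2) / ε) := sum_le_sum fun i _ => h1 i
    _ = _ := by rw [sum_add_distrib, ← sum_div]; simp

lemma abs_pottsPhi_sub_meanFieldSup_le {n q : ℕ} (hq : 0 < q) {A : Matrix (Fin n) (Fin n) ℝ}
    (hA : A.IsSymm) (J : Matrix (Fin q) (Fin q) ℝ) (h : Fin q → ℝ) {ε : ℝ} (hε : 0 < ε) :
    |pottsPhi A J h - meanFieldSup A J h| ≤
      (q * log q + q + ∑ r, ∑ s, J r s ^ 2 + ∑ r, ∑ s, |J r s|) *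
        (n * ε + Matrix.trace (A * A) / ε + Matrix.trace (A * A) / ε ^ 2) := by
  rw [trace_mul_self_eq_sum_sq hA]
  have h1 := pottsPhi_le A J h hq (inv_pos.2 hε) (pow_pos hε 2)
  have h2 := meanFieldSup_le A J h hq
  have h3 := sum_abs_diagonal_le A hε
  set T := ∑ i, ∑ j, A i j ^ 2
  have hK : 0 ≤ ∑ r, ∑ s, J r s ^ 2 := by positivity
  have hB : 0 ≤ ∑ r, ∑ s, |J r s| := by positivity
  set K := ∑ r, ∑ s, J r s ^ 2
  set B := ∑ r, ∑ s, |J r s|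
  have hl : 0 ≤ log q := log_nonneg (by exact_mod_cast hq)
  have hT : 0 ≤ T := by positivity
  have h4 := mul_le_mul_of_nonneg_right h3 hB
  have e1 : (n : ℝ) * q / ε⁻¹ * log q = q * log q * (n * ε) := by field_simp
  have e2 : T * K / ε ^ 2 = K * (T / ε ^ 2) := by ring
  have e3 : (n : ℝ) * q * ε⁻¹ * ε ^ 2 = q * (n * ε) := by field_simp
  rw [e1, e2, e3] at h1
  have p1 : 0 ≤ (n : ℝ) * ε := by positivity
  have p2 : 0 ≤ T / ε := by positivity
  have p3 : 0 ≤ T / ε ^ 2 := by positivity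
  generalize (n : ℝ) * ε = a at *
  generalize T / ε = b at *
  generalize T / ε ^ 2 = c at *
  have hL : 0 ≤ (q : ℝ) * log q := by positivity
  have hq0 : (0 : ℝ) ≤ q := by positivity
  generalize (q : ℝ) * log q = L at *
  rw [abs_le]
  have := mul_nonneg hL p1
  have := mul_nonneg hL p2
  have := mul_nonneg hL p3
  have := mul_nonneg hq0 p1
  have := mul_nonneg hq0 p2
  have := mul_nonneg hq0 p3
  have := mul_nonneg hK p1
  have := mul_nonneg hK p2
  have := mul_nonneg hK p3
  have := mul_nonneg hB p1
  have := mul_nonneg hB p2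
  have := mul_nonneg hB p3
  constructor <;> linarith

theorem mean_field_universality (q : ℕ) (hq : 2 ≤ q)
    (J : Matrix (Fin q) (Fin q) ℝ) (hJ : J.IsSymm) (h : Fin q → ℝ)
    (A : (n : ℕ) → Matrix (Fin n) (Fin n) ℝ) (hsymm : ∀ n, (A n).IsSymm)
    (hMF : meanFieldAssumption A) :
    Tendsto (fun n : ℕ =>
        (1 / (n : ℝ)) * (pottsPhi (A n) J h - meanFieldSup (A n) J h))
      atTop (nhds 0) := by
  have hq0 : 0 < q := by omega
  set C := q * log q + q + ∑ r, ∑ s, J r s ^ 2 + ∑ r, ∑ s, |J r s| with hC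
  have hC0 : 0 ≤ C := by
    have : 0 ≤ log (q : ℝ) := log_nonneg (by exact_mod_cast hq0)
    positivity
  have hbound : ∀ ε > 0, ∀ᶠ n : ℕ in atTop,
      |(1 / (n : ℝ)) * (pottsPhi (A n) J h - meanFieldSup (A n) J h)| ≤
        C * (ε + ε ^ 2 + ε) := by
    intro ε hε
    filter_upwards [hMF.2.eventually_le_const (pow_pos hε 3), eventually_gt_atTop 0] with n hn hn0
    have hn' : (0 : ℝ) < n := by exact_mod_cast hn0
    rw [abs_mul, abs_of_pos (one_div_pos.2 hn'), one_div_mul_eq_div, div_le_iff₀ hn']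
    refine (abs_pottsPhi_sub_meanFieldSup_le hq0 (hsymm n) J h hε).trans ?_
    rw [← hC, mul_assoc]
    refine mul_le_mul_of_nonneg_left ?_ hC0
    rw [div_le_iff₀ hn'] at hn
    have h1 : Matrix.trace (A n * A n) / ε ≤ ε ^ 2 * n := by
      rw [div_le_iff₀ hε]; linarith
    have h2 : Matrix.trace (A n * A n) / ε ^ 2 ≤ ε * n := by
      rw [div_le_iff₀ (pow_pos hε 2)]; linarith
    linarith
  rw [Metric.tendsto_nhds]
  intro e he
  have hlim : Tendsto (fun ε : ℝ => C * (ε + ε ^ 2 + ε)) (nhdsWithin 0 (Set.Ioi 0)) (nhds 0) := by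
    have : Continuous fun ε : ℝ => C * (ε + ε ^ 2 + ε) := by fun_prop
    simpa using (this.tendsto 0).mono_left nhdsWithin_le_nhds
  obtain ⟨ε, hεe, hε⟩ := ((hlim.eventually_lt_const he).and self_mem_nhdsWithin).exists
  filter_upwards [hbound ε hε] with n hn
  rw [dist_zero_right, Real.norm_eq_abs]
  exact hn.trans_lt hεe
end

section
/- Let (A_n) be an asymptotically regular sequence of symmetric matrices, let q = 2, J = β·I_2 with 0 ≤ β ≤ 2, and h ∈ ℝ² with h(1) = h(2), and let μ_n be the corresponding Potts (Ising) measure on {1,2}^n. Then for every δ > 0 there exists ε > 0 such that for all sufficiently large n, μ_n({y : (1/n)·Σ_{i=1}^n (1{y_i=1} − 1{y_i=2}) ∈ [−δ, δ]}) ≥ 1 − e^{−n·ε}. -/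
open Finset Filter Real

open scoped Classical in
/-- Mass that the Potts measure `μ_n(y) = exp(H(y) - Φ)` assigns to a set of configurations. -/
noncomputable def pottsMass {n q : ℕ} (A : Matrix (Fin n) (Fin n) ℝ)
    (J : Matrix (Fin q) (Fin q) ℝ) (h : Fin q → ℝ) (S : Set (Fin n → Fin q)) : ℝ :=
  ∑ y ∈ Finset.univ.filter (fun y => y ∈ S), Real.exp (pottsH A J h y - pottsPhi A J h)

open scoped Classical in
def asympRegular (A : (n : ℕ) → Matrix (Fin n) (Fin n) ℝ) : Prop :=
  meanFieldAssumption A ∧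
  (∀ n : ℕ, ∀ i j : Fin n, 0 ≤ A n i j) ∧
  (∀ δ : ℝ, 0 < δ →
    Tendsto (fun n : ℕ =>
        ((Finset.univ.filter (fun i : Fin n => δ < |(∑ j, A n i j) - 1|)).card : ℝ) / n)
      atTop (nhds 0)) ∧
  Tendsto (fun n : ℕ => (∑ i, ∑ j, A n i j) / n) atTop (nhds 1)

/-- Average magnetization: spin values `0 : Fin 2` (color 1) and `1 : Fin 2` (color 2). -/
noncomputable def avgMagnet {n : ℕ} (y : Fin n → Fin 2) : ℝ :=
  (1 / (n : ℝ)) *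
    ∑ i, ((if y i = 0 then (1 : ℝ) else 0) - (if y i = 1 then (1 : ℝ) else 0))

/-- The gap between a real number and its hyperbolic tangent increases on the positive axis. -/
lemma strictMonoOn_sub_sinh_div_cosh :
    StrictMonoOn (fun w : ℝ => w - Real.sinh w / Real.cosh w) (Set.Ici 0) := by
  have hd : ∀ w : ℝ, HasDerivAt (fun w : ℝ => w - Real.sinh w / Real.cosh w)
      (Real.sinh w ^ 2 / Real.cosh w ^ 2) w := by
    intro w
    have hc := (Real.cosh_pos w).ne'
    refine ((hasDerivAt_id' w).sub ((Real.hasDerivAt_sinh w).div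
      (Real.hasDerivAt_cosh w) hc)).congr_deriv ?_
    field_simp
    ring
  refine strictMonoOn_of_deriv_pos (convex_Ici 0)
    (fun w _ => (hd w).continuousAt.continuousWithinAt) fun w hw => ?_
  rw [interior_Ici, Set.mem_Ioi] at hw
  rw [(hd w).deriv]
  have := Real.sinh_pos_iff.2 hw
  have := Real.cosh_pos w
  positivity

lemma exists_cosh_add_le_exp {a : ℝ} (ha : 0 < a) :
    ∃ t : ℝ, 0 < t ∧ ∀ u : ℝ, Real.cosh (u + t) ≤ Real.exp (u ^ 2 / 2 + a * t) := by
  set t := a - Real.sinh a / Real.cosh a with ht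
  have hpos : 0 < t := by
    simpa [ht] using strictMonoOn_sub_sinh_div_cosh (Set.mem_Ici.2 le_rfl) (Set.mem_Ici.2 ha.le) ha
  have hd : ∀ w : ℝ, HasDerivAt (fun w : ℝ => w ^ 2 / 2 - t * w - Real.log (Real.cosh w))
      (w - t - Real.sinh w / Real.cosh w) w := by
    intro w
    have hc := (Real.cosh_pos w).ne'
    refine (((((hasDerivAt_id' w).pow 2).div_const 2).sub ((hasDerivAt_id' w).const_mul t)).sub
      ((Real.hasDerivAt_cosh w).log hc)).congr_deriv ?_
    simp
  have hlog : ∀ w : ℝ, Real.log (Real.cosh w) ≤ w ^ 2 / 2 := fun w =>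
    (Real.log_le_iff_le_exp (Real.cosh_pos w)).2 (Real.cosh_le_exp_half_sq w)
  have hkey : ∀ w : ℝ, Real.log (Real.cosh w) ≤ w ^ 2 / 2 - t * w + a * t := by
    intro w
    rcases le_total w a with hw | hw
    · nlinarith [hlog w]
    · have hmono : MonotoneOn (fun w : ℝ => w ^ 2 / 2 - t * w - Real.log (Real.cosh w))
          (Set.Ici a) := by
        refine monotoneOn_of_deriv_nonneg (convex_Ici a)
          (fun w _ => (hd w).continuousAt.continuousWithinAt)
          (fun w _ => (hd w).differentiableAt.differentiableWithinAt) fun x hx => ?_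
        rw [interior_Ici, Set.mem_Ioi] at hx
        rw [(hd x).deriv]
        have := strictMonoOn_sub_sinh_div_cosh (Set.mem_Ici.2 ha.le)
          (Set.mem_Ici.2 (ha.trans hx).le) hx
        simp only at this
        linarith
      have := hmono (Set.mem_Ici.2 le_rfl) (Set.mem_Ici.2 hw) hw
      simp only at this
      nlinarith [hlog a]
  refine ⟨t, hpos, fun u => ?_⟩
  rw [← Real.log_le_iff_le_exp (Real.cosh_pos _)]
  nlinarith [hkey (u + t)]

/-- A standard Gaussian linearises an exponential square. -/
lemma integral_exp_mul_gaussianReal (c : ℝ) :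
    ∫ x, Real.exp (c * x) ∂ProbabilityTheory.gaussianReal 0 1 = Real.exp (c ^ 2 / 2) := by
  have := ProbabilityTheory.mgf_gaussianReal (p := ProbabilityTheory.gaussianReal 0 1)
    (X := id) (μ := 0) (v := 1) (by simp) c
  simpa [ProbabilityTheory.mgf] using this

lemma gaussianPDFReal_smul_exp_sq (l x : ℝ) :
    ProbabilityTheory.gaussianPDFReal 0 1 x • Real.exp (l * x ^ 2 / 2) =
      (√(2 * Real.pi))⁻¹ * Real.exp (-((1 - l) / 2) * x ^ 2) := by
  simp only [ProbabilityTheory.gaussianPDFReal, smul_eq_mul, mul_assoc, ← Real.exp_add]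
  simp
  left
  ring

lemma integrable_exp_sq_gaussianReal {l : ℝ} (hl : l < 1) :
    MeasureTheory.Integrable (fun x => Real.exp (l * x ^ 2 / 2))
      (ProbabilityTheory.gaussianReal 0 1) := by
  rw [ProbabilityTheory.gaussianReal_of_var_ne_zero 0 one_ne_zero,
    MeasureTheory.integrable_withDensity_iff_integrable_smul' (by fun_prop)
      (by simp [ProbabilityTheory.gaussianPDF])]
  simp only [ProbabilityTheory.toReal_gaussianPDF, gaussianPDFReal_smul_exp_sq]
  exact (integrable_exp_neg_mul_sq (by linarith)).const_mul _

lemma integral_exp_sq_gaussianReal {l : ℝ} (hl : l < 1) :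
    ∫ x, Real.exp (l * x ^ 2 / 2) ∂ProbabilityTheory.gaussianReal 0 1 = √(1 / (1 - l)) := by
  rw [ProbabilityTheory.integral_gaussianReal_eq_integral_smul one_ne_zero]
  simp only [gaussianPDFReal_smul_exp_sq]
  rw [MeasureTheory.integral_const_mul, integral_gaussian, ← Real.sqrt_inv,
    ← Real.sqrt_mul (by positivity)]
  congr 1
  have : 1 - l ≠ 0 := by linarith
  field_simp

lemma integral_exp_sq_gaussianReal_le {l η : ℝ} (h0 : 0 ≤ l) (hη : 0 < η) (hl : l ≤ 1 - η) :
    ∫ x, Real.exp (l * x ^ 2 / 2) ∂ProbabilityTheory.gaussianReal 0 1 ≤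
      Real.exp (l / (2 * η)) := by
  rw [integral_exp_sq_gaussianReal (by linarith)]
  refine Real.sqrt_le_iff.2 ⟨(Real.exp_pos _).le, ?_⟩
  rw [← Real.exp_nat_mul]
  have h1 : (1 : ℝ) / (1 - l) ≤ l / η + 1 := by
    rw [div_le_iff₀ (by linarith)]
    have : (l / η + 1) * (1 - l) = 1 + l / η * ((1 - η) - l) := by field_simp; ring
    rw [this]
    have : 0 ≤ l / η * ((1 - η) - l) := mul_nonneg (by positivity) (by linarith)
    linarith
  refine h1.trans ((Real.add_one_le_exp _).trans (le_of_eq ?_))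
  congr 1
  push_cast
  field_simp

/-- The value `±1` of the two colours. -/
noncomputable def spin (b : Fin 2) : ℝ := if b = 0 then 1 else -1

lemma sum_prod_exp_spin {n : ℕ} (g : Fin n → ℝ) :
    ∑ y : Fin n → Fin 2, Real.exp (∑ i, g i * spin (y i)) = ∏ i, 2 * Real.cosh (g i) := by
  have := Finset.prod_univ_sum (fun _ : Fin n => (Finset.univ : Finset (Fin 2)))
    (fun i b => Real.exp (g i * spin b))
  rw [Fintype.piFinset_univ] at this
  simp only [Real.exp_sum]
  rw [← this]
  refine Finset.prod_congr rfl fun i _ => ?_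
  simp [Fin.sum_univ_two, spin, Real.cosh_eq]
  ring

/-- Gaussian linearisation of a diagonalised Ising Hamiltonian with external field `t`. -/
lemma sum_exp_diagonal_le {n : ℕ} {ι : Type*} [Fintype ι] (V : ι → Fin n → ℝ) (L : ι → ℝ)
    (hV : ∀ x : ι → ℝ, ∑ i, (∑ k, x k * V k i) ^ 2 = ∑ k, x k ^ 2)
    {η a t : ℝ} (hη : 0 < η) (h0 : ∀ k, 0 ≤ L k) (h1 : ∀ k, L k ≤ 1 - η)
    (ht : ∀ u, Real.cosh (u + t) ≤ Real.exp (u ^ 2 / 2 + a)) :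
    ∑ y : Fin n → Fin 2, Real.exp ((∑ k, L k * (∑ i, V k i * spin (y i)) ^ 2) / 2
        + t * ∑ i, spin (y i)) ≤
      2 ^ n * Real.exp (n * a + (∑ k, L k) / (2 * η)) := by
  set γ := ProbabilityTheory.gaussianReal 0 1
  set P := MeasureTheory.Measure.pi (fun _ : ι => γ)
  have hlin : ∀ y : Fin n → Fin 2,
      Real.exp ((∑ k, L k * (∑ i, V k i * spin (y i)) ^ 2) / 2 + t * ∑ i, spin (y i)) =
      ∫ x, (∏ k, Real.exp ((√(L k) * ∑ i, V k i * spin (y i)) * x k)) *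
        Real.exp (t * ∑ i, spin (y i)) ∂P := by
    intro y
    rw [MeasureTheory.integral_mul_const, MeasureTheory.integral_fintype_prod_eq_prod
      (fun k x => Real.exp ((√(L k) * ∑ i, V k i * spin (y i)) * x)), Real.exp_add,
      Finset.sum_div, Real.exp_sum]
    congr 1
    refine Finset.prod_congr rfl fun k _ => ?_
    rw [integral_exp_mul_gaussianReal, mul_pow, Real.sq_sqrt (h0 k)]
  have hint : ∀ y : Fin n → Fin 2, MeasureTheory.Integrable
      (fun x : ι → ℝ => (∏ k, Real.exp ((√(L k) * ∑ i, V k i * spin (y i)) * x k)) *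
        Real.exp (t * ∑ i, spin (y i))) P := fun y =>
    (MeasureTheory.Integrable.fintype_prod
      (f := fun k x => Real.exp ((√(L k) * ∑ i, V k i * spin (y i)) * x))
      fun k => ProbabilityTheory.integrable_exp_mul_gaussianReal _).mul_const _
  simp_rw [hlin]
  rw [← MeasureTheory.integral_finsetSum _ fun y _ => hint y]
  have hsq : MeasureTheory.Integrable (fun x : ι → ℝ => ∏ k, Real.exp (L k * x k ^ 2 / 2)) P :=
    MeasureTheory.Integrable.fintype_prod (f := fun k x => Real.exp (L k * x ^ 2 / 2))
      fun k => integrable_exp_sq_gaussianReal (by linarith [h1 k])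
  calc _ ≤ ∫ x : ι → ℝ, (2 ^ n * Real.exp (n * a)) * ∏ k, Real.exp (L k * x k ^ 2 / 2) ∂P := by
        refine MeasureTheory.integral_mono (MeasureTheory.integrable_finsetSum _ fun y _ => hint y)
          (hsq.const_mul _) fun x => ?_
        simp only
        set g : Fin n → ℝ := fun i => ∑ k, (√(L k) * x k) * V k i
        have hg : ∑ i, g i ^ 2 = ∑ k, L k * x k ^ 2 := by
          rw [hV]
          simp_rw [mul_pow, Real.sq_sqrt (h0 _)]
        have hexp : ∀ y : Fin n → Fin 2,
            (∏ k, Real.exp ((√(L k) * ∑ i, V k i * spin (y i)) * x k)) *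
              Real.exp (t * ∑ i, spin (y i)) = Real.exp (∑ i, (g i + t) * spin (y i)) := by
          intro y
          rw [← Real.exp_sum, ← Real.exp_add]
          congr 1
          simp only [g, add_mul, Finset.sum_add_distrib, Finset.mul_sum, Finset.sum_mul]
          rw [Finset.sum_comm]
          congr 1
          refine Finset.sum_congr rfl fun i _ => Finset.sum_congr rfl fun k _ => by ring
        simp_rw [hexp]
        rw [sum_prod_exp_spin, Finset.prod_mul_distrib, Finset.prod_const, Finset.card_univ,
          Fintype.card_fin, mul_assoc]
        refine mul_le_mul_of_nonneg_left ?_ (by positivity)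
        calc _ ≤ ∏ i, Real.exp (g i ^ 2 / 2 + a) :=
              Finset.prod_le_prod (fun i _ => (Real.cosh_pos _).le) fun i _ => ht _
          _ = _ := by
              rw [← Real.exp_sum, ← Real.exp_sum, ← Real.exp_add, Finset.sum_add_distrib,
                ← Finset.sum_div, ← Finset.sum_div, hg]
              simp [add_comm]
    _ = (2 ^ n * Real.exp (n * a)) * ∏ k, ∫ x, Real.exp (L k * x ^ 2 / 2) ∂γ := by
        rw [MeasureTheory.integral_const_mul, MeasureTheory.integral_fintype_prod_eq_prod
          (fun k x => Real.exp (L k * x ^ 2 / 2))]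
    _ ≤ (2 ^ n * Real.exp (n * a)) * ∏ k, Real.exp (L k / (2 * η)) := by
        refine mul_le_mul_of_nonneg_left (Finset.prod_le_prod
          (fun k _ => MeasureTheory.integral_nonneg fun x => (Real.exp_pos _).le)
          fun k _ => integral_exp_sq_gaussianReal_le (h0 k) hη (h1 k)) (by positivity)
    _ = _ := by rw [← Real.exp_sum, mul_assoc, ← Real.exp_add, Finset.sum_div]

lemma exists_orthogonal_diagonalization {n : ℕ} {M : Matrix (Fin n) (Fin n) ℝ} (hM : M.IsSymm) :
    ∃ (U : Matrix (Fin n) (Fin n) ℝ) (m : Fin n → ℝ),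
      U.transpose * U = 1 ∧ M = U * Matrix.diagonal m * U.transpose := by
  have hH : M.IsHermitian := by
    simpa [Matrix.IsHermitian] using hM.eq
  refine ⟨hH.eigenvectorUnitary, hH.eigenvalues, ?_, ?_⟩
  · simpa [Matrix.star_eq_conjTranspose] using
      Matrix.mem_unitaryGroup_iff'.1 hH.eigenvectorUnitary.2
  · have := hH.spectral_theorem
    rw [Unitary.conjStarAlgAut_apply] at this
    simpa [Matrix.star_eq_conjTranspose, Function.comp_def] using this

/-- A symmetric quadratic form is dominated by its positive part, whose eigenvalues are controlled
by an upper bound for the form and whose trace is controlled by `tr (M ^ 2)`. -/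
lemma exists_positive_part {n : ℕ} {M : Matrix (Fin n) (Fin n) ℝ} (hM : M.IsSymm) {r : ℝ}
    (hr : 0 ≤ r) (hle : ∀ x : Fin n → ℝ, ∑ i, ∑ j, M i j * (x i * x j) ≤ r * ∑ i, x i ^ 2) :
    ∃ (V : Fin n → Fin n → ℝ) (L : Fin n → ℝ),
      (∀ x : Fin n → ℝ, ∑ i, (∑ k, x k * V k i) ^ 2 = ∑ k, x k ^ 2) ∧
      (∀ k, 0 ≤ L k) ∧ (∀ k, L k ≤ r) ∧ ∑ k, L k ^ 2 ≤ Matrix.trace (M * M) ∧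
      ∀ x : Fin n → ℝ, ∑ i, ∑ j, M i j * (x i * x j) ≤ ∑ k, L k * (∑ i, V k i * x i) ^ 2 := by
  obtain ⟨U, m, hU, rfl⟩ := exists_orthogonal_diagonalization hM
  set M := U * Matrix.diagonal m * U.transpose with hMdef
  have hnorm : ∀ x : Fin n → ℝ, ∑ i, (∑ k, x k * U i k) ^ 2 = ∑ k, x k ^ 2 := by
    intro x
    have h : U.mulVec x ⬝ᵥ U.mulVec x = x ⬝ᵥ x := by
      rw [Matrix.dotProduct_mulVec, Matrix.vecMul_mulVec, ← Matrix.dotProduct_mulVec, hU,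
        Matrix.one_mulVec]
    simpa [dotProduct, Matrix.mulVec, sq, mul_comm] using h
  have hquad : ∀ x : Fin n → ℝ,
      ∑ i, ∑ j, M i j * (x i * x j) = ∑ k, m k * (∑ i, U i k * x i) ^ 2 := by
    intro x
    have h : x ⬝ᵥ M.mulVec x =
        U.transpose.mulVec x ⬝ᵥ (Matrix.diagonal m).mulVec (U.transpose.mulVec x) := by
      rw [hMdef, ← Matrix.mulVec_mulVec, ← Matrix.mulVec_mulVec, Matrix.dotProduct_mulVec,
        Matrix.mulVec_transpose]
    simp only [dotProduct, Matrix.mulVec_diagonal] at h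
    simp only [Matrix.mulVec, dotProduct, Matrix.transpose_apply, Finset.mul_sum] at h
    calc _ = ∑ i, ∑ j, x i * (M i j * x j) :=
          Finset.sum_congr rfl fun i _ => Finset.sum_congr rfl fun j _ => by ring
      _ = _ := h
      _ = _ := Finset.sum_congr rfl fun k _ => by rw [sq, ← mul_assoc, Finset.mul_sum]; ring_nf
  have hm : ∀ k, m k ≤ r := by
    intro k
    have h1 := hle fun i => U i k
    have horth : ∀ l, ∑ i, U i l * U i k = if l = k then 1 else 0 := by
      intro l
      have := congrFun (congrFun hU l) k
      simpa [Matrix.mul_apply, Matrix.one_apply] using this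
    have h2 : ∑ i, U i k ^ 2 = 1 := by simpa [sq] using horth k
    rw [hquad, h2] at h1
    simpa [horth] using h1
  have htr : Matrix.trace (M * M) = ∑ k, m k ^ 2 := by
    have : M * M = U * (Matrix.diagonal m * Matrix.diagonal m) * U.transpose := by
      calc _ = U * Matrix.diagonal m * (U.transpose * U) * Matrix.diagonal m * U.transpose := by
            simp only [hMdef, Matrix.mul_assoc]
        _ = _ := by rw [hU, Matrix.mul_one]; simp only [Matrix.mul_assoc]
    rw [this, Matrix.trace_mul_comm, ← Matrix.mul_assoc, hU, Matrix.one_mul,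
      Matrix.diagonal_mul_diagonal, Matrix.trace_diagonal]
    simp [sq]
  refine ⟨fun k i => U i k, fun k => max (m k) 0, hnorm, fun k => le_max_right _ _,
    fun k => max_le (hm k) hr, ?_, fun x => ?_⟩
  · rw [htr]
    refine Finset.sum_le_sum fun k _ => ?_
    rcases le_total (m k) 0 with h | h
    · simp [h, sq_nonneg]
    · simp [h]
  · rw [hquad]
    exact Finset.sum_le_sum fun k _ => mul_le_mul_of_nonneg_right (le_max_left _ _) (sq_nonneg _)

/-- Gaussian upper bound for the partition function of an Ising model with small `tr (M ^ 2)`. -/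
lemma sum_exp_quadratic_le {n : ℕ} {M : Matrix (Fin n) (Fin n) ℝ} (hM : M.IsSymm)
    {η a t : ℝ} (hη : 0 < η) (hη1 : η ≤ 1)
    (hle : ∀ x : Fin n → ℝ, ∑ i, ∑ j, M i j * (x i * x j) ≤ (1 - η) * ∑ i, x i ^ 2)
    (htr : Matrix.trace (M * M) ≤ η ^ 4 * n)
    (ht : ∀ u, Real.cosh (u + t) ≤ Real.exp (u ^ 2 / 2 + a)) :
    ∑ y : Fin n → Fin 2, Real.exp ((∑ i, ∑ j, M i j * (spin (y i) * spin (y j))) / 2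
        + t * ∑ i, spin (y i)) ≤ 2 ^ n * Real.exp (n * (a + η)) := by
  obtain ⟨V, L, hV, h0, h1, hsq, hdom⟩ := exists_positive_part hM (sub_nonneg.2 hη1) hle
  have hL : ∑ k, L k ≤ η ^ 2 * n := by
    have hcs := sq_sum_le_card_mul_sum_sq (s := Finset.univ) (f := L)
    rw [Finset.card_univ, Fintype.card_fin] at hcs
    refine abs_le_of_sq_le_sq' ?_ (by positivity) |>.2
    calc _ ≤ (n : ℝ) * ∑ k, L k ^ 2 := hcs
      _ ≤ n * (η ^ 4 * n) := by gcongr; exact hsq.trans htr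
      _ = _ := by ring
  have hL' : (∑ k, L k) / (2 * η) ≤ n * η := by
    rw [div_le_iff₀ (by positivity)]
    nlinarith [(Nat.cast_nonneg n : (0 : ℝ) ≤ n), sq_nonneg η, mul_nonneg (sq_nonneg η)
      (Nat.cast_nonneg n : (0 : ℝ) ≤ n)]
  calc _ ≤ ∑ y : Fin n → Fin 2, Real.exp ((∑ k, L k * (∑ i, V k i * spin (y i)) ^ 2) / 2
        + t * ∑ i, spin (y i)) := by
        refine Finset.sum_le_sum fun y _ => Real.exp_le_exp.2 ?_
        linarith [hdom fun i => spin (y i)]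
    _ ≤ 2 ^ n * Real.exp (n * a + (∑ k, L k) / (2 * η)) := sum_exp_diagonal_le V L hV hη h0 h1 ht
    _ ≤ _ := by
        gcongr
        linarith

lemma abs_spin (b : Fin 2) : |spin b| = 1 := by
  unfold spin; split_ifs <;> simp

lemma spin_sq (b : Fin 2) : spin b ^ 2 = 1 := by
  rw [← sq_abs, abs_spin, one_pow]

lemma spin_one_sub (b : Fin 2) : spin (1 - b) = -spin b := by
  fin_cases b <;> simp [spin]

/-- Distinct spins are uncorrelated under the uniform measure. -/
lemma sum_spin_mul_spin_nonneg {n : ℕ} (i j : Fin n) :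
    0 ≤ ∑ y : Fin n → Fin 2, spin (y i) * spin (y j) := by
  rcases eq_or_ne i j with rfl | hij
  · exact Finset.sum_nonneg fun y _ => mul_self_nonneg _
  · refine le_of_eq (Eq.symm ?_)
    refine Finset.sum_involution (fun y _ => Function.update y i (1 - y i)) ?_ ?_ ?_ ?_
    · intro y _
      simp [Function.update_of_ne hij.symm, spin_one_sub]
    · intro y _ _ h
      have := congrArg spin (congrFun h i)
      rw [Function.update_self, spin_one_sub] at this
      have h0 := abs_spin (y i)
      have : spin (y i) = 0 := by linarith
      simp [this] at h0
    · simp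
    · intro y _
      simp

lemma two_pow_le_sum_exp {n : ℕ} {A : Matrix (Fin n) (Fin n) ℝ} (hA : ∀ i j, 0 ≤ A i j) {c : ℝ}
    (hc : 0 ≤ c) :
    (2 : ℝ) ^ n ≤ ∑ y : Fin n → Fin 2,
      Real.exp (c * ∑ i, ∑ j, A i j * (spin (y i) * spin (y j))) := by
  have h0 : 0 ≤ ∑ y : Fin n → Fin 2, c * ∑ i, ∑ j, A i j * (spin (y i) * spin (y j)) := by
    rw [← Finset.mul_sum, Finset.sum_comm]
    refine mul_nonneg hc (Finset.sum_nonneg fun i _ => ?_)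
    rw [Finset.sum_comm]
    refine Finset.sum_nonneg fun j _ => ?_
    rw [← Finset.mul_sum]
    exact mul_nonneg (hA i j) (sum_spin_mul_spin_nonneg i j)
  calc (2 : ℝ) ^ n = ∑ y : Fin n → Fin 2, 1 := by simp
    _ ≤ ∑ y : Fin n → Fin 2, (c * ∑ i, ∑ j, A i j * (spin (y i) * spin (y j)) + 1) := by
        rw [Finset.sum_add_distrib]; linarith
    _ ≤ _ := Finset.sum_le_sum fun y _ => Real.add_one_le_exp _

lemma pottsH_eq {n : ℕ} (A : Matrix (Fin n) (Fin n) ℝ) (β : ℝ) (h : Fin 2 → ℝ) (hh : h 0 = h 1)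
    (y : Fin n → Fin 2) :
    pottsH A (β • (1 : Matrix (Fin 2) (Fin 2) ℝ)) h y =
      (β / 4 * ∑ i, ∑ j, A i j + n * h 0) +
        β / 4 * ∑ i, ∑ j, A i j * (spin (y i) * spin (y j)) := by
  have h1 : ∀ b c : Fin 2, (β • (1 : Matrix (Fin 2) (Fin 2) ℝ)) b c =
      β / 2 + β / 2 * (spin b * spin c) := by
    intro b c
    fin_cases b <;> fin_cases c <;> simp [spin]
  have h2 : ∀ b, h b = h 0 := by
    intro b
    fin_cases b
    · rfl
    · exact hh.symm
  have h3 : ∑ i, h (y i) = n * h 0 := by simp [h2]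
  unfold pottsH
  rw [h3]
  simp only [h1, mul_add, Finset.sum_add_distrib, Finset.mul_sum]
  have h4 : ∀ i j, (1 / 2 : ℝ) * (A i j * (β / 2)) = β / 4 * A i j := fun i j => by ring
  have h5 : ∀ i j, (1 / 2 : ℝ) * (A i j * (β / 2 * (spin (y i) * spin (y j)))) =
      β / 4 * (A i j * (spin (y i) * spin (y j))) := fun i j => by ring
  simp only [h4, h5]
  ring

lemma avgMagnet_eq {n : ℕ} (y : Fin n → Fin 2) :
    avgMagnet y = (∑ i, spin (y i)) / n := by
  have : ∀ b : Fin 2, ((if b = 0 then (1 : ℝ) else 0) - (if b = 1 then (1 : ℝ) else 0)) =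
      spin b := by
    intro b
    fin_cases b <;> simp [spin]
  simp only [avgMagnet, this]
  ring

/-- Schur's test for a nonnegative symmetric matrix. -/
lemma quadratic_le_of_row_sum_le {n : ℕ} {B : Matrix (Fin n) (Fin n) ℝ} (hB : B.IsSymm)
    (h0 : ∀ i j, 0 ≤ B i j) {r : ℝ} (hr : ∀ i, ∑ j, B i j ≤ r) (x : Fin n → ℝ) :
    ∑ i, ∑ j, B i j * (x i * x j) ≤ r * ∑ i, x i ^ 2 := by
  have hswap : ∑ i, ∑ j, B i j * x j ^ 2 = ∑ i, ∑ j, B i j * x i ^ 2 := by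
    rw [Finset.sum_comm]
    exact Finset.sum_congr rfl fun i _ => Finset.sum_congr rfl fun j _ => by rw [hB.apply]
  calc _ ≤ ∑ i, ∑ j, (B i j * x i ^ 2 + B i j * x j ^ 2) / 2 := by
        refine Finset.sum_le_sum fun i _ => Finset.sum_le_sum fun j _ => ?_
        nlinarith [mul_nonneg (h0 i j) (sq_nonneg (x i - x j))]
    _ = ∑ i, (∑ j, B i j) * x i ^ 2 := by
        simp only [← Finset.sum_div, Finset.sum_add_distrib, hswap, Finset.sum_mul]
        ring
    _ ≤ ∑ i, r * x i ^ 2 :=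
        Finset.sum_le_sum fun i _ => mul_le_mul_of_nonneg_right (hr i) (sq_nonneg _)
    _ = _ := by rw [Finset.mul_sum]

/-- Few irregular rows carry little total weight. -/
lemma sum_row_sum_irregular_le {n : ℕ} {R : Fin n → ℝ} {η : ℝ} (hη : 0 ≤ η) (hη1 : η ≤ 1)
    (s : Finset (Fin n)) (hs : ∀ i ∉ s, 1 - η ≤ R i) (hcard : (s.card : ℝ) ≤ η * n)
    (hsum : ∑ i, R i ≤ (1 + η) * n) : ∑ i ∈ s, R i ≤ 3 * η * n := by
  have h1 : ∑ i ∈ sᶜ, (1 - η) ≤ ∑ i ∈ sᶜ, R i :=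
    Finset.sum_le_sum fun i hi => hs i (Finset.mem_compl.1 hi)
  have h2 : (s.card : ℝ) + sᶜ.card = n := by
    exact_mod_cast (Finset.card_add_card_compl s).trans (Fintype.card_fin n)
  rw [Finset.sum_const, nsmul_eq_mul] at h1
  have h3 := Finset.sum_add_sum_compl s R
  have hn : (0 : ℝ) ≤ n := Nat.cast_nonneg n
  have h4 : (1 - η) * (n - η * n) ≤ (1 - η) * (sᶜ.card : ℝ) :=
    mul_le_mul_of_nonneg_left (by linarith) (by linarith)
  nlinarith [mul_nonneg (mul_nonneg hη hη) hn]

/-- Upper bound for the partition function of a nearly regular mean-field Ising model. -/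
lemma sum_exp_ising_le {n : ℕ} {A : Matrix (Fin n) (Fin n) ℝ} (hA : A.IsSymm)
    (hA0 : ∀ i j, 0 ≤ A i j) {c η a t : ℝ} (hc0 : 0 ≤ c) (hc1 : c ≤ 1) (hη : 0 < η)
    (hη1 : η ≤ 1 / 4) (s : Finset (Fin n)) (hs : ∀ i ∉ s, |∑ j, A i j - 1| ≤ η)
    (hcard : (s.card : ℝ) ≤ η * n) (hsum : ∑ i, ∑ j, A i j ≤ (1 + η) * n)
    (htr : Matrix.trace (A * A) ≤ η ^ 4 * n)
    (ht : ∀ u, Real.cosh (u + t) ≤ Real.exp (u ^ 2 / 2 + a)) :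
    ∑ y : Fin n → Fin 2, Real.exp (c / 2 * (∑ i, ∑ j, A i j * (spin (y i) * spin (y j)))
        + t * ∑ i, spin (y i)) ≤ 2 ^ n * Real.exp (n * (a + 6 * η)) := by
  set B : Matrix (Fin n) (Fin n) ℝ :=
    Matrix.of fun i j => if i ∈ s ∨ j ∈ s then 0 else A i j
  have hBapp : ∀ i j, B i j = if i ∈ s ∨ j ∈ s then 0 else A i j := fun i j => rfl
  have hB : B.IsSymm := by
    ext i j
    rw [Matrix.transpose_apply, hBapp, hBapp, hA.apply]
    simp only [or_comm]
  have hB0 : ∀ i j, 0 ≤ B i j := fun i j => by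
    rw [hBapp]; split_ifs
    exacts [le_rfl, hA0 i j]
  have hBA : ∀ i j, B i j ≤ A i j := fun i j => by
    rw [hBapp]; split_ifs
    exacts [hA0 i j, le_rfl]
  have hrow : ∀ i, ∑ j, B i j ≤ 1 + η := by
    intro i
    by_cases hi : i ∈ s
    · simp only [hBapp, hi, true_or, if_true, Finset.sum_const_zero]
      linarith
    · have h1 := (abs_le.1 (hs i hi)).2
      have h2 := Finset.sum_le_sum fun j (_ : j ∈ Finset.univ) => hBA i j
      linarith
  have hquad := quadratic_le_of_row_sum_le hB hB0 hrow
  have hn : (0 : ℝ) ≤ n := Nat.cast_nonneg n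
  have hirr := sum_row_sum_irregular_le hη.le (by linarith) s
    (fun i hi => by linarith [(abs_le.1 (hs i hi)).1]) hcard hsum
  have hκ0 : 0 ≤ c * (1 - 2 * η) := mul_nonneg hc0 (by linarith)
  have hκ1 : c * (1 - 2 * η) ≤ 1 - 2 * η := mul_le_of_le_one_left (by linarith) hc1
  have hMA : ∀ i j, (c * (1 - 2 * η)) * B i j ≤ A i j := fun i j =>
    (mul_le_of_le_one_left (hB0 i j) (by linarith)).trans (hBA i j)
  have hbound := sum_exp_quadratic_le (M := (c * (1 - 2 * η)) • B) (n := n)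
    (by rw [Matrix.IsSymm, Matrix.transpose_smul, hB.eq]) (η := η) (a := a) (t := t) hη
    (by linarith) (fun x => by
      simp only [Matrix.smul_apply, smul_eq_mul, mul_assoc (c * (1 - 2 * η)), ← Finset.mul_sum]
      have hx : 0 ≤ ∑ i, x i ^ 2 := Finset.sum_nonneg fun i _ => sq_nonneg _
      calc _ ≤ (c * (1 - 2 * η)) * ((1 + η) * ∑ i, x i ^ 2) :=
            mul_le_mul_of_nonneg_left (hquad x) hκ0
        _ ≤ (1 - 2 * η) * ((1 + η) * ∑ i, x i ^ 2) :=
            mul_le_mul_of_nonneg_right hκ1 (by positivity)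
        _ ≤ _ := by nlinarith [mul_nonneg hη.le hx, mul_nonneg (sq_nonneg η) hx])
    (le_trans (by
      simp only [Matrix.trace, Matrix.diag, Matrix.mul_apply, Matrix.smul_apply, smul_eq_mul]
      exact Finset.sum_le_sum fun i _ => Finset.sum_le_sum fun j _ =>
        mul_le_mul (hMA i j) (hMA j i) (mul_nonneg hκ0 (hB0 j i)) (hA0 i j)) htr) ht
  have hcut : ∀ σ : Fin n → ℝ, (∀ i, |σ i| = 1) → ∑ i, ∑ j, A i j * (σ i * σ j) ≤
      ∑ i, ∑ j, B i j * (σ i * σ j) + 6 * η * n := by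
    intro σ hσ
    have hprod : ∀ i j, σ i * σ j ≤ 1 := fun i j =>
      (le_abs_self _).trans (by rw [abs_mul, hσ, hσ, one_mul])
    have hterm : ∀ i j, A i j * (σ i * σ j) ≤ B i j * (σ i * σ j) +
        ((if i ∈ s then A i j else 0) + (if j ∈ s then A i j else 0)) := by
      intro i j
      have := mul_le_of_le_one_right (hA0 i j) (hprod i j)
      have := hA0 i j
      rw [hBapp]
      by_cases hi : i ∈ s <;> by_cases hj : j ∈ s <;> simp [hi, hj] <;> linarith
    have h1 : ∑ i, ∑ j, (if i ∈ s then A i j else 0) = ∑ i ∈ s, ∑ j, A i j := by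
      have : ∀ i, ∑ j, (if i ∈ s then A i j else 0) = if i ∈ s then ∑ j, A i j else 0 :=
        fun i => by split_ifs <;> simp
      simp [this]
    have h2 : ∑ i, ∑ j, (if j ∈ s then A i j else 0) = ∑ i ∈ s, ∑ j, A i j := by
      rw [Finset.sum_comm, ← h1]
      exact Finset.sum_congr rfl fun i _ => Finset.sum_congr rfl fun j _ => by rw [hA.apply]
    have h3 := Finset.sum_le_sum fun i (_ : i ∈ Finset.univ) =>
      Finset.sum_le_sum fun j (_ : j ∈ Finset.univ) => hterm i j
    simp only [Finset.sum_add_distrib, h1, h2] at h3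
    linarith
  have hcmp : ∀ y : Fin n → Fin 2,
      c / 2 * (∑ i, ∑ j, A i j * (spin (y i) * spin (y j))) ≤
        (∑ i, ∑ j, ((c * (1 - 2 * η)) • B) i j * (spin (y i) * spin (y j))) / 2 + 5 * η * n := by
    intro y
    simp only [Matrix.smul_apply, smul_eq_mul, mul_assoc (c * (1 - 2 * η)), ← Finset.mul_sum]
    have h1 := hcut (fun i => spin (y i)) fun i => abs_spin _
    have h2 := hquad fun i => spin (y i)
    simp only [spin_sq, Finset.sum_const, Finset.card_univ, Fintype.card_fin, nsmul_eq_mul,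
      mul_one] at h2
    have h3 := mul_le_mul_of_nonneg_left h1 hc0
    have h4 := mul_le_mul_of_nonneg_left h2 (mul_nonneg hc0 hη.le)
    have h5 : c * (η * n) ≤ η * n := mul_le_of_le_one_left (by positivity) hc1
    have h6 : c * η * ((1 + η) * n) ≤ 2 * (η * n) := by
      calc c * η * ((1 + η) * n) = (1 + η) * (c * (η * n)) := by ring
        _ ≤ 2 * (η * n) := mul_le_mul (by linarith) h5 (by positivity) (by norm_num)
    linarith
  calc _ ≤ ∑ y : Fin n → Fin 2, Real.exp (5 * η * n) *
        Real.exp ((∑ i, ∑ j, ((c * (1 - 2 * η)) • B) i j * (spin (y i) * spin (y j))) / 2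
          + t * ∑ i, spin (y i)) := by
        refine Finset.sum_le_sum fun y _ => ?_
        rw [← Real.exp_add]
        exact Real.exp_le_exp.2 (by linarith [hcmp y])
    _ ≤ Real.exp (5 * η * n) * (2 ^ n * Real.exp (n * (a + η))) := by
        rw [← Finset.mul_sum]
        exact mul_le_mul_of_nonneg_left hbound (Real.exp_pos _).le
    _ = _ := by
        rw [mul_left_comm, ← Real.exp_add]
        congr 2
        ring

lemma one_sub_pottsMass {n q : ℕ} [NeZero q] (A : Matrix (Fin n) (Fin n) ℝ)
    (J : Matrix (Fin q) (Fin q) ℝ) (h : Fin q → ℝ) (S : Set (Fin n → Fin q)) :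
    1 - pottsMass A J h S = pottsMass A J h Sᶜ := by
  have htot : ∑ y : Fin n → Fin q, Real.exp (pottsH A J h y - pottsPhi A J h) = 1 := by
    have hpos : 0 < ∑ y : Fin n → Fin q, Real.exp (pottsH A J h y) :=
      Finset.sum_pos (fun y _ => Real.exp_pos _) Finset.univ_nonempty
    simp only [Real.exp_sub, ← Finset.sum_div]
    rw [pottsPhi, Real.exp_log hpos, div_self hpos.ne']
  classical
  rw [← htot, ← Finset.sum_filter_add_sum_filter_not Finset.univ (· ∈ S)]
  rw [sub_eq_iff_eq_add']
  simp only [pottsMass, Set.mem_compl_iff]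

/-- Exponential Markov bound for the Ising measure of the configurations with large
magnetization. -/
lemma pottsMass_compl_le {n : ℕ} (hn : 0 < n) {A : Matrix (Fin n) (Fin n) ℝ}
    (hA0 : ∀ i j, 0 ≤ A i j) {β : ℝ} (hβ : 0 ≤ β) {h : Fin 2 → ℝ} (hh : h 0 = h 1) {δ t b : ℝ}
    (ht : 0 ≤ t)
    (hpos : ∑ y : Fin n → Fin 2, Real.exp (β / 4 * (∑ i, ∑ j, A i j * (spin (y i) * spin (y j)))
        + t * ∑ i, spin (y i)) ≤ 2 ^ n * Real.exp (n * b))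
    (hneg : ∑ y : Fin n → Fin 2, Real.exp (β / 4 * (∑ i, ∑ j, A i j * (spin (y i) * spin (y j)))
        + -t * ∑ i, spin (y i)) ≤ 2 ^ n * Real.exp (n * b)) :
    pottsMass A (β • (1 : Matrix (Fin 2) (Fin 2) ℝ)) h {y | avgMagnet y ∈ Set.Icc (-δ) δ}ᶜ ≤
      2 * Real.exp (n * (b - t * δ)) := by
  classical
  have hn' : (0 : ℝ) < n := Nat.cast_pos.2 hn
  set X : (Fin n → Fin 2) → ℝ :=
    fun y => β / 4 * ∑ i, ∑ j, A i j * (spin (y i) * spin (y j))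
  set K : ℝ := β / 4 * ∑ i, ∑ j, A i j + n * h 0
  have hH : ∀ y, pottsH A (β • (1 : Matrix (Fin 2) (Fin 2) ℝ)) h y = K + X y :=
    pottsH_eq A β h hh
  have hZ : (2 : ℝ) ^ n ≤ ∑ y, Real.exp (X y) :=
    two_pow_le_sum_exp hA0 (by positivity)
  have hZpos : 0 < ∑ y, Real.exp (X y) := lt_of_lt_of_le (by positivity) hZ
  have hw : ∀ y, Real.exp (pottsH A (β • (1 : Matrix (Fin 2) (Fin 2) ℝ)) h y -
      pottsPhi A (β • (1 : Matrix (Fin 2) (Fin 2) ℝ)) h) =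
      Real.exp (X y) / ∑ y, Real.exp (X y) := by
    intro y
    rw [Real.exp_sub, pottsPhi, Real.exp_log
      (Finset.sum_pos (fun y _ => Real.exp_pos _) Finset.univ_nonempty)]
    simp only [hH, Real.exp_add, ← Finset.mul_sum]
    rw [mul_div_mul_left _ _ (Real.exp_pos K).ne']
  have htail : ∀ y ∈ Finset.univ.filter
      (fun y : Fin n → Fin 2 => y ∈ {y | avgMagnet y ∈ Set.Icc (-δ) δ}ᶜ),
      Real.exp (X y) ≤ Real.exp (-(n * (t * δ))) * (Real.exp (X y + t * ∑ i, spin (y i)) +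
        Real.exp (X y + -t * ∑ i, spin (y i))) := by
    intro y hy
    simp only [Finset.mem_filter, Finset.mem_univ, true_and, Set.mem_compl_iff, Set.mem_ofPred_eq,
      Set.mem_Icc, avgMagnet_eq, le_div_iff₀ hn', div_le_iff₀ hn', not_and_or, not_le] at hy
    rw [mul_add, ← Real.exp_add, ← Real.exp_add]
    rcases hy with hy | hy
    · refine le_add_of_nonneg_of_le (Real.exp_pos _).le (Real.exp_le_exp.2 ?_)
      nlinarith
    · refine le_add_of_le_of_nonneg (Real.exp_le_exp.2 ?_) (Real.exp_pos _).le
      nlinarith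
  have hsum : ∑ y ∈ Finset.univ.filter
      (fun y : Fin n → Fin 2 => y ∈ {y | avgMagnet y ∈ Set.Icc (-δ) δ}ᶜ), Real.exp (X y) ≤
      2 * Real.exp (n * (b - t * δ)) * 2 ^ n := by
    calc _ ≤ _ := Finset.sum_le_sum htail
      _ ≤ ∑ y, Real.exp (-(n * (t * δ))) * (Real.exp (X y + t * ∑ i, spin (y i)) +
        Real.exp (X y + -t * ∑ i, spin (y i))) :=
          Finset.sum_le_sum_of_subset_of_nonneg (Finset.filter_subset _ _)
            fun y _ _ => by positivity
      _ ≤ Real.exp (-(n * (t * δ))) * (2 ^ n * Real.exp (n * b) + 2 ^ n * Real.exp (n * b)) := by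
          rw [← Finset.mul_sum, Finset.sum_add_distrib]
          exact mul_le_mul_of_nonneg_left (add_le_add hpos hneg) (Real.exp_pos _).le
      _ = _ := by
          rw [show (n : ℝ) * (b - t * δ) = -(n * (t * δ)) + n * b by ring, Real.exp_add]
          ring
  unfold pottsMass
  simp only [hw, ← Finset.sum_div]
  rw [div_le_iff₀ hZpos]
  refine le_trans (le_of_eq ?_) (hsum.trans (mul_le_mul_of_nonneg_left hZ (by positivity)))
  congr!

theorem ising_concentration_subcritical
    (A : (n : ℕ) → Matrix (Fin n) (Fin n) ℝ) (hsymm : ∀ n, (A n).IsSymm)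
    (hreg : asympRegular A) (β : ℝ) (hβ0 : 0 ≤ β) (hβ2 : β ≤ 2)
    (h : Fin 2 → ℝ) (hh : h 0 = h 1) (δ : ℝ) (hδ : 0 < δ) :
    ∃ ε : ℝ, 0 < ε ∧ ∀ᶠ n : ℕ in atTop,
      1 - Real.exp (-(n : ℝ) * ε) ≤
        pottsMass (A n) (β • (1 : Matrix (Fin 2) (Fin 2) ℝ)) h
          {y | avgMagnet y ∈ Set.Icc (-δ) δ} := by
  obtain ⟨⟨-, htr⟩, hA0, hrow, hsum⟩ := hreg
  obtain ⟨t, ht, hcosh⟩ := exists_cosh_add_le_exp (half_pos hδ)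
  have hcosh' : ∀ u, Real.cosh (u + -t) ≤ Real.exp (u ^ 2 / 2 + δ / 2 * t) := fun u => by
    simpa [← Real.cosh_neg (u + -t), neg_add_eq_sub, sub_eq_add_neg, add_comm] using hcosh (-u)
  let η : ℝ := min (t * δ / 24) (1 / 4)
  have hη : 0 < η := lt_min (by positivity) (by norm_num)
  have hη1 : η ≤ 1 / 4 := min_le_right _ _
  have hη2 : η ≤ t * δ / 24 := min_le_left _ _
  have hε : 0 < t * δ / 8 := by positivity
  have hlarge : ∀ᶠ n : ℕ in atTop, (2 : ℝ) ≤ Real.exp (n * (t * δ / 8)) :=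
    (Real.tendsto_exp_atTop.comp
      (tendsto_natCast_atTop_atTop.atTop_mul_const hε)).eventually_ge_atTop 2
  refine ⟨t * δ / 8, hε, ?_⟩
  filter_upwards [hlarge, eventually_gt_atTop 0, htr.eventually_le_const (pow_pos hη 4),
    (hrow η hη).eventually_le_const hη,
    hsum.eventually_le_const (show (1 : ℝ) < 1 + η by linarith)] with n h2 hn htrn hrown hsumn
  have hn' : (0 : ℝ) < n := Nat.cast_pos.2 hn
  rw [div_le_iff₀ hn'] at htrn hrown hsumn
  have hpart : ∀ s : ℝ, (∀ u, Real.cosh (u + s) ≤ Real.exp (u ^ 2 / 2 + δ / 2 * t)) →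
      ∑ y : Fin n → Fin 2, Real.exp (β / 4 * (∑ i, ∑ j, A n i j * (spin (y i) * spin (y j)))
        + s * ∑ i, spin (y i)) ≤ 2 ^ n * Real.exp (n * (δ / 2 * t + 6 * η)) := by
    intro s hs
    have := sum_exp_ising_le (hsymm n) (hA0 n) (c := β / 2) (by linarith) (by linarith) hη hη1 _
      (fun i hi => by simpa using hi) hrown hsumn htrn hs
    simpa only [div_div, show (2 : ℝ) * 2 = 4 by norm_num] using this
  have hmass := pottsMass_compl_le hn (hA0 n) hβ0 hh (δ := δ) ht.le (hpart t hcosh)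
    (hpart (-t) hcosh')
  rw [← one_sub_pottsMass] at hmass
  have hfinal : 2 * Real.exp (n * (δ / 2 * t + 6 * η - t * δ)) ≤
      Real.exp (-(n : ℝ) * (t * δ / 8)) := by
    calc _ ≤ Real.exp (n * (t * δ / 8)) * Real.exp (n * (-(t * δ / 4))) := by
          gcongr
          linarith
      _ = _ := by
          rw [← Real.exp_add]
          ring_nf
  linarith
end
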